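/- arXiv:0901.0618 — 3 statements merged into one kernel-verified Lean document; each statement's English description precedes it below -/
import Mathlib

section
/- Let X = (X,a), Y = (Y,b) be V-categories and let X̂ be the V-category of all V-functors X^op → V, with structure 1_{X̂}^*(t,s) = ⋀_{x∈X} (t(x) ⊸ s(x)). Then: (i) η_X : X ⇸ X̂ given by η_X(x,t) = t(x) is a V-module; (ii) for every V-module φ : X ⇸ Y, the Yoneda mate y_φ : Y → X̂, y_φ(y) = φ(−,y), is a V-functor and is the unique V-functor Φ : Y → X̂ satisfying ⋁_{t∈X̂} t(x) ⊗ 1_{X̂}^*(t, Φ(y)) = φ(x,y) for all x ∈ X, y ∈ Y. (This exhibits the functor (−)^* : (VCat)^op → VMod as having a left adjoint with unit η.) -/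
universe u v

/-- A commutative unital quantale: a complete lattice with a commutative monoid
structure whose multiplication preserves arbitrary suprema in each variable,
and whose unit `k = 1` satisfies `⊥ < 1`. -/
class CommQuantale (V : Type u) extends CompleteLattice V, CommMonoid V where
  mul_sSup : ∀ (a : V) (s : Set V), a * sSup s = ⨆ b ∈ s, a * b
  bot_lt_one : (⊥ : V) < 1

variable {V : Type u} [CommQuantale V]

/-- The internal hom `x ⊸ y` of the quantale, characterized by `z ≤ x ⊸ y ↔ z * x ≤ y`. -/
def qhom (x y : V) : V := sSup {z : V | z * x ≤ y}

/-- `a : X → X → V` is a `V`-category structure. -/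
def IsVCat {X : Type*} (a : X → X → V) : Prop :=
  (∀ x, (1 : V) ≤ a x x) ∧ (∀ x y z, a x y * a y z ≤ a x z)

/-- `f` is a `V`-functor from `(X,a)` to `(Y,b)`. -/
def IsVFun {X Y : Type*} (a : X → X → V) (b : Y → Y → V) (f : X → Y) : Prop :=
  ∀ x y, a x y ≤ b (f x) (f y)

/-- `φ` is a `V`-module from `(X,a)` to `(Y,b)`. -/
def IsVMod {X Y : Type*} (a : X → X → V) (b : Y → Y → V) (φ : X → Y → V) : Prop :=
  (∀ x' x y, a x' x * φ x y ≤ φ x' y) ∧ (∀ x y y', φ x y * b y y' ≤ φ x y')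

/-- The Hausdorff formula: for `φ = a` this is the Hausdorff structure `h_X` on `P X`;
for a `V`-module `φ` it is the lax (Hausdorff) extension `H̃φ`. -/
def hf {X Y : Type*} (φ : X → Y → V) (A : Set X) (B : Set Y) : V :=
  ⨅ x ∈ A, ⨆ y ∈ B, φ x y

/-- Module composition: `mcomp φ ψ` is `ψ · φ` in the paper's notation. -/
def mcomp {X Y Z : Type*} (φ : X → Y → V) (ψ : Y → Z → V) : X → Z → V :=
  fun x z => ⨆ y, φ x y * ψ y z

/-- The Gromov–Hausdorff "distance": the join of `H̃φ(X,Y)` over all `V`-modules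
`φ : X ⇸ Y`. -/
def GH {X Y : Type*} (a : X → X → V) (b : Y → Y → V) : V :=
  ⨆ φ : {φ : X → Y → V // IsVMod a b φ}, hf φ.1 Set.univ Set.univ

/-- `X̂`: the V-category of V-functors `X^op → V`, i.e. maps `t : X → V` with
`a(q,p) ⊗ t(p) ≤ t(q)`. -/
def Xhat {X : Type*} (a : X → X → V) : Type _ :=
  {t : X → V // ∀ p q, a q p * t p ≤ t q}

/-- The structure `1_{X̂}^*(t,s) = ⋀_x (t(x) ⊸ s(x))` on `X̂`. -/
def hatHom {X : Type*} (a : X → X → V) (t s : Xhat a) : V :=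
  ⨅ x, qhom (t.1 x) (s.1 x)

/-- The Yoneda mate `y_φ : Y → X̂`, `y_φ(y) = φ(−,y)`, of a V-module `φ : X ⇸ Y`. -/
def ymate {X Y : Type*} {a : X → X → V} {b : Y → Y → V} (φ : X → Y → V)
    (hφ : IsVMod a b φ) : Y → Xhat a :=
  fun y => ⟨fun x => φ x y, fun p q => hφ.1 q p y⟩

theorem q_mul_mono (c : V) {x y : V} (h : x ≤ y) : c * x ≤ c * y := by
  have h1 := CommQuantale.mul_sSup c {x, y}
  have h2 : sSup {x, y} = y := by rw [sSup_pair]; exact sup_eq_right.mpr h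
  rw [h2] at h1
  rw [h1]
  exact le_iSup₂_of_le (f := fun b (_ : b ∈ ({x, y} : Set V)) => c * b) x (by simp) le_rfl

theorem q_adj {x y z : V} : z ≤ qhom x y ↔ z * x ≤ y := by
  constructor
  · intro h
    rw [mul_comm]
    refine (q_mul_mono x h).trans ?_
    unfold qhom
    rw [CommQuantale.mul_sSup]
    refine iSup₂_le fun b hb => ?_
    rw [mul_comm]
    exact hb
  · intro h
    exact le_sSup h

theorem hat_adj {X : Type*} {a : X → X → V} {t s : Xhat a} {z : V} :
    z ≤ hatHom a t s ↔ ∀ x, t.1 x * z ≤ s.1 x := by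
  unfold hatHom
  rw [le_iInf_iff]
  exact forall_congr' fun x => by rw [q_adj, mul_comm]

theorem hat_sup {X : Type*} {a : X → X → V} (s : Xhat a) (x : X) :
    (⨆ t : Xhat a, t.1 x * hatHom a t s) = s.1 x := by
  apply le_antisymm
  · exact iSup_le fun t => hat_adj.1 le_rfl x
  · refine le_trans ?_ (le_iSup (fun t : Xhat a => t.1 x * hatHom a t s) s)
    have h : (1 : V) ≤ hatHom a s s := hat_adj.2 fun x => by rw [mul_one]
    simpa using q_mul_mono (s.1 x) h

/-- (i) `η_X : X ⇸ X̂`, `η_X(x,t) = t(x)`, is a V-module; (ii) for every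
V-module `φ : X ⇸ Y`, the Yoneda mate `y_φ` is a V-functor and is the unique V-functor
`Φ : Y → X̂` with `⋁_t t(x) ⊗ 1_{X̂}^*(t, Φ(y)) = φ(x,y)` for all `x, y`.  (This
exhibits `(−)^* : (VCat)^op → VMod` as having a left adjoint with unit `η`.) -/
theorem yoneda_adjunction {X Y : Type*} (a : X → X → V) (b : Y → Y → V)
    (ha : IsVCat a) (hb : IsVCat b) (φ : X → Y → V) (hφ : IsVMod a b φ) :
    IsVMod a (hatHom a) (fun x (t : Xhat a) => t.1 x) ∧
    IsVFun b (hatHom a) (ymate φ hφ) ∧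
    (∀ (x : X) (y : Y), (⨆ t : Xhat a, t.1 x * hatHom a t (ymate φ hφ y)) = φ x y) ∧
    (∀ Φ : Y → Xhat a, IsVFun b (hatHom a) Φ →
      (∀ (x : X) (y : Y), (⨆ t : Xhat a, t.1 x * hatHom a t (Φ y)) = φ x y) →
      Φ = ymate φ hφ) := by
  refine ⟨⟨fun x' x t => t.2 x x', fun x t s => hat_adj.1 le_rfl x⟩,
    fun y y' => hat_adj.2 fun x => hφ.2 x y y', fun x y => hat_sup (ymate φ hφ y) x, ?_⟩
  intro Φ _ h
  funext y
  apply Subtype.ext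
  funext x
  exact (hat_sup (Φ y) x).symm.trans (h x y)
end

section
/- Define, for each V-category X = (X,a), the V-modules δ_X : X ⇸ HX by δ_X(x,B) = a(x,B) = ⋁_{y∈B} a(x,y), and ν_X : HHX ⇸ HX by ν_X(𝒜,B) = h_X(⋃𝒜, B). Then (H̃, δ, ν) is a lax monad on VMod: the monad equations hold strictly (ν_X · H̃δ_X = 1_X^*-lifted identities, etc., since they hold for the monad ℍ = (H, {-}, ⋃) on VCat with δ_X = ({-})_* and ν_X = (⋃)_*), and moreover the naturality squares for δ and ν commute strictly: for every V-module φ : X ⇸ Y, δ_Y · φ = H̃φ · δ_X and ν_Y · H̃H̃φ = H̃φ · ν_X. -/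
universe u v

variable {V : Type u} [CommQuantale V]

/-- The unit `δ_X : X ⇸ HX`, `δ_X(x,B) = a(x,B) = ⋁_{y∈B} a(x,y)`. -/
def deltaMod {X : Type*} (a : X → X → V) : X → Set X → V :=
  fun x B => ⨆ y ∈ B, a x y

/-- The multiplication `ν_X : HHX ⇸ HX`, `ν_X(𝒜,B) = h_X(⋃𝒜, B)`. -/
def nuMod {X : Type*} (a : X → X → V) : Set (Set X) → Set X → V :=
  fun 𝒜 B => hf a (⋃₀ 𝒜) B

theorem q_mul_mono_s9 {p q r s : V} (h : p ≤ q) (h' : r ≤ s) : p * r ≤ q * s := by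
  have key : ∀ (c x y : V), x ≤ y → c * x ≤ c * y := by
    intro c x y hxy
    have h1 := CommQuantale.mul_sSup c {x, y}
    rw [sSup_pair, sup_eq_right.mpr hxy] at h1
    rw [h1]
    exact le_iSup₂_of_le x (by simp) le_rfl
  calc p * r ≤ p * s := key _ _ _ h'
    _ = s * p := mul_comm _ _
    _ ≤ s * q := key _ _ _ h
    _ = q * s := mul_comm _ _

theorem q_mul_biSup_le {Y : Type*} {B : Set Y} {f : Y → V} {c d : V}
    (h : ∀ y ∈ B, c * f y ≤ d) : c * (⨆ y ∈ B, f y) ≤ d := by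
  rw [← sSup_image, CommQuantale.mul_sSup]
  refine iSup₂_le ?_
  rintro _ ⟨y, hy, rfl⟩
  exact h y hy

theorem hf_comp_le {X Y Z : Type*} {φ : X → Y → V} {ψ : Y → Z → V} {χ : X → Z → V}
    (h : ∀ x y z, φ x y * ψ y z ≤ χ x z) (A : Set X) (B : Set Y) (C : Set Z) :
    hf φ A B * hf ψ B C ≤ hf χ A C := by
  refine le_iInf₂ fun x hx => ?_
  refine (q_mul_mono_s9 (iInf₂_le x hx) le_rfl).trans ?_
  rw [mul_comm]
  refine q_mul_biSup_le fun y hy => ?_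
  refine (q_mul_mono_s9 (iInf₂_le y hy) le_rfl).trans ?_
  rw [mul_comm]
  refine q_mul_biSup_le fun z hz => ?_
  exact (h x y z).trans (le_iSup₂_of_le z hz le_rfl)

theorem hf_refl {X : Type*} {a : X → X → V} (h : ∀ x, 1 ≤ a x x) (A : Set X) :
    1 ≤ hf a A A :=
  le_iInf₂ fun x hx => le_iSup₂_of_le x hx (h x)

theorem hf_hf_le {X Y : Type*} (φ : X → Y → V) (𝒜 : Set (Set X)) (ℬ : Set (Set Y)) :
    hf (hf φ) 𝒜 ℬ ≤ hf φ (⋃₀ 𝒜) (⋃₀ ℬ) := by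
  refine le_iInf₂ ?_
  rintro x ⟨A, hA, hx⟩
  refine (iInf₂_le A hA).trans (iSup₂_le fun B hB => ?_)
  refine (iInf₂_le x hx).trans (iSup₂_le fun y hy => ?_)
  exact le_iSup₂_of_le y ⟨B, hB, hy⟩ le_rfl

theorem le_hf_hf {X Y : Type*} (φ : X → Y → V) (𝒜 : Set (Set X)) (B : Set Y) :
    hf φ (⋃₀ 𝒜) B ≤ hf (hf φ) 𝒜 {B} := by
  refine le_iInf₂ fun A hA => le_iSup₂_of_le B rfl (le_iInf₂ fun x hx => ?_)
  exact iInf₂_le x ⟨A, hA, hx⟩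

theorem le_mul_of_one {p q r : V} (h : p ≤ q) (h' : 1 ≤ r) : p ≤ q * r := by
  simpa using q_mul_mono_s9 h h'

theorem le_one_mul_of {p q r : V} (h : p ≤ q) (h' : 1 ≤ r) : p ≤ r * q := by
  simpa using q_mul_mono_s9 h' h

theorem delta_eq {X : Type*} (a : X → X → V) (x : X) (B : Set X) :
    deltaMod a x B = hf a {x} B := by simp [deltaMod, hf]

theorem hf_delta {X : Type*} (a : X → X → V) (A : Set X) (ℬ : Set (Set X)) :
    hf (deltaMod a) A ℬ = hf a A (⋃₀ ℬ) := by
  simp only [deltaMod, hf]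
  refine iInf_congr fun x => iInf_congr fun _ => ?_
  rw [← sSup_image, ← sSup_image]
  apply le_antisymm
  · refine sSup_le ?_
    rintro _ ⟨B, hB, rfl⟩
    exact iSup₂_le fun y hy => le_sSup ⟨y, ⟨B, hB, hy⟩, rfl⟩
  · refine sSup_le ?_
    rintro _ ⟨y, ⟨B, hB, hy⟩, rfl⟩
    exact le_sSup_of_le ⟨B, hB, rfl⟩ (le_iSup₂_of_le y hy le_rfl)

theorem hf_nu {X : Type*} (a : X → X → V) (𝔸 : Set (Set (Set X))) (ℬ : Set (Set X)) :
    hf (nuMod a) 𝔸 ℬ = hf (hf a) (Set.sUnion '' 𝔸) ℬ := by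
  conv_rhs => rw [hf]
  rw [iInf_image]
  rfl

theorem nu_lem {X Y : Type*} {b : Y → Y → V} {φ : X → Y → V} (hb : IsVCat b)
    (h : ∀ x y y', φ x y * b y y' ≤ φ x y') (𝒜 : Set (Set X)) (B : Set Y) :
    (⨆ ℬ, hf (hf φ) 𝒜 ℬ * nuMod b ℬ B) = hf φ (⋃₀ 𝒜) B := by
  apply le_antisymm
  · exact iSup_le fun ℬ => (q_mul_mono_s9 (hf_hf_le φ 𝒜 ℬ) le_rfl).trans (hf_comp_le h _ _ _)
  · refine le_iSup_of_le {B} (le_mul_of_one (le_hf_hf φ 𝒜 B) ?_)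
    simpa [nuMod] using hf_refl hb.1 B

theorem left_lem {X Y : Type*} {a : X → X → V} {φ : X → Y → V} (ha : IsVCat a)
    (h : ∀ x' x y, a x' x * φ x y ≤ φ x' y) (A : Set X) (B : Set Y) :
    (⨆ A', hf a A A' * hf φ A' B) = hf φ A B :=
  le_antisymm (iSup_le fun _ => hf_comp_le h _ _ _)
    (le_iSup_of_le A (le_one_mul_of le_rfl (hf_refl ha.1 A)))

/-- `(H̃, δ, ν)` is a lax monad on VMod: `δ_X` and `ν_X` are V-modules,
the monad equations hold strictly (`ν_X · H̃δ_X = 1`, `ν_X · δ_{HX} = 1`,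
`ν_X · ν_{HX} = ν_X · H̃ν_X`), and the naturality squares for `δ` and `ν` commute
strictly: `δ_Y · φ = H̃φ · δ_X` and `ν_Y · H̃H̃φ = H̃φ · ν_X` for every V-module `φ`.
(Recall `mcomp ρ σ` denotes the composite `σ · ρ`.) -/
theorem hausdorff_lax_monad {X Y : Type v} (a : X → X → V) (b : Y → Y → V)
    (ha : IsVCat a) (hb : IsVCat b) :
    IsVMod a (hf a) (deltaMod a) ∧
    IsVMod (hf (hf a)) (hf a) (nuMod a) ∧
    mcomp (hf (deltaMod a)) (nuMod a) = hf a ∧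
    mcomp (deltaMod (hf a)) (nuMod a) = hf a ∧
    mcomp (nuMod (hf a)) (nuMod a) = mcomp (hf (nuMod a)) (nuMod a) ∧
    (∀ φ : X → Y → V, IsVMod a b φ →
      mcomp φ (deltaMod b) = mcomp (deltaMod a) (hf φ) ∧
      mcomp (hf (hf φ)) (nuMod b) = mcomp (nuMod a) (hf φ)) := by
  refine ⟨⟨?_, ?_⟩, ⟨?_, ?_⟩, ?_, ?_, ?_, ?_⟩
  · intro x' x B
    exact q_mul_biSup_le fun y hy => (ha.2 x' x y).trans (le_iSup₂_of_le y hy le_rfl)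
  · intro x B B'
    rw [delta_eq, delta_eq]
    exact hf_comp_le ha.2 _ _ _
  · intro 𝒜' 𝒜 B
    exact (q_mul_mono_s9 (hf_hf_le a 𝒜' 𝒜) le_rfl).trans (hf_comp_le ha.2 _ _ _)
  · intro 𝒜 B B'
    exact hf_comp_le ha.2 _ _ _
  · funext A B
    simp only [mcomp, hf_delta, nuMod]
    apply le_antisymm
    · exact iSup_le fun _ => hf_comp_le ha.2 _ _ _
    · refine le_iSup_of_le {B} ?_
      simpa using le_mul_of_one (le_refl (hf a A B)) (hf_refl ha.1 B)
  · funext A B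
    simp only [mcomp, delta_eq]
    rw [nu_lem ha ha.2]
    simp
  · funext 𝔸 B
    simp only [mcomp, hf_nu]
    rw [nu_lem ha ha.2]
    simp only [nuMod]
    have h := nu_lem ha ha.2 (⋃₀ 𝔸) B
    simp only [nuMod] at h
    rw [h]
    congr 1
    ext x
    simp only [Set.mem_sUnion, Set.mem_image]
    constructor
    · rintro ⟨A, ⟨𝒜, h1, h2⟩, h3⟩
      exact ⟨_, ⟨𝒜, h1, rfl⟩, A, h2, h3⟩
    · rintro ⟨_, ⟨𝒜, h1, rfl⟩, A, h2, h3⟩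
      exact ⟨A, ⟨𝒜, h1, h2⟩, h3⟩
  · intro φ hφ
    constructor
    · funext x B
      simp only [mcomp, delta_eq]
      rw [left_lem ha hφ.1]
      apply le_antisymm
      · refine iSup_le fun y => ?_
        refine le_trans ?_ (hf_comp_le hφ.2 {x} {y} B)
        exact q_mul_mono_s9 (by simp [hf]) le_rfl
      · rw [show hf φ {x} B = ⨆ y ∈ B, φ x y by simp [hf]]
        refine iSup₂_le fun y hy => ?_
        refine le_iSup_of_le y (le_mul_of_one le_rfl ?_)
        rw [← delta_eq]
        exact le_iSup₂_of_le y hy (hb.1 y)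
    · funext 𝒜 B
      simp only [mcomp]
      rw [nu_lem hb hφ.2]
      exact (left_lem ha hφ.1 _ _).symm
end

section
/- The Hausdorff construction is a V-functor on the Gromov–Hausdorff V-category: for all V-categories X and Y, GH(X,Y) ≤ GH(HX, HY). -/
universe u v

variable {V : Type u} [CommQuantale V]

theorem q_mul_iSup {ι : Sort*} (a : V) (f : ι → V) : a * (⨆ i, f i) = ⨆ i, a * f i := by
  rw [iSup, CommQuantale.mul_sSup, iSup_range]

theorem q_mul_le_left (a : V) {b c : V} (h : b ≤ c) : a * b ≤ a * c := by
  have h1 := CommQuantale.mul_sSup a {b, c}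
  rw [sSup_pair, sup_eq_right.2 h] at h1
  rw [h1]
  exact le_iSup₂_of_le b (by simp) le_rfl

theorem q_mul_le {a b c d : V} (h : a ≤ b) (h' : c ≤ d) : a * c ≤ b * d := by
  refine (q_mul_le_left a h').trans ?_
  rw [mul_comm a, mul_comm b]
  exact q_mul_le_left d h

theorem hf_comp {X Y Z : Type*} (f : X → Y → V) (g : Y → Z → V) (k : X → Z → V)
    (H : ∀ x y z, f x y * g y z ≤ k x z) (A : Set X) (B : Set Y) (C : Set Z) :
    hf f A B * hf g B C ≤ hf k A C := by
  refine le_iInf₂ fun x hx => ?_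
  refine (q_mul_le (iInf₂_le x hx) le_rfl).trans ?_
  rw [mul_comm, q_mul_iSup]
  refine iSup_le fun y => ?_
  rw [q_mul_iSup]
  refine iSup_le fun hy => ?_
  rw [mul_comm]
  refine (q_mul_le_left _ (iInf₂_le y hy)).trans ?_
  rw [q_mul_iSup]
  refine iSup_le fun z => ?_
  rw [q_mul_iSup]
  exact iSup_le fun hz => (H x y z).trans (le_iSup₂_of_le z hz le_rfl)

/-- the Hausdorff construction is a V-functor on the Gromov–Hausdorff
V-category: `GH(X,Y) ≤ GH(HX,HY)`. -/
theorem GH_hausdorff_functor {X Y : Type v} (a : X → X → V) (b : Y → Y → V)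
    (ha : IsVCat a) (hb : IsVCat b) :
    GH a b ≤ GH (hf a) (hf b) := by
  refine iSup_le fun φ => ?_
  refine le_iSup_of_le ⟨hf φ.1, fun A' A B => hf_comp _ _ _ φ.2.1 A' A B,
    fun A B B' => hf_comp _ _ _ φ.2.2 A B B'⟩ ?_
  refine le_iInf₂ fun A _ => le_iSup₂_of_le Set.univ (Set.mem_univ _) ?_
  exact le_iInf₂ fun x _ => iInf₂_le x (Set.mem_univ x)
end
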